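/- arXiv:2501.13680 — 2 statements merged into one kernel-verified Lean document; each statement's English description precedes it below -/
import Mathlib

section
/- Let K be a field of characteristic zero, g = (g_1, ..., g_n) ∈ K[x_1, ..., x_n]^n, and s ≥ 0 an integer. Then the ideal ⟨x_1' − g_1, 𝓛*_g(x_1' − g_1), ..., (𝓛*_g)^s(x_1' − g_1)⟩ of K[x_1, x_1', ..., x_1^{(s+1)}, x_2, ..., x_n] equals I_g ∩ K[x_1, x_1', ..., x_1^{(s+1)}, x_2, ..., x_n]. Furthermore, this ideal is also equal to ⟨x_1' − g_1, x_1'' − 𝓛_g(g_1), ..., x_1^{(s+1)} − 𝓛_g^s(g_1)⟩. -/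
open MvPolynomial

noncomputable section

/-- The canonical derivation on the ring of differential polynomials
`K[x_i^{(j)} : 1 ≤ i ≤ n, j ≥ 0]`, sending `x_i^{(j)}` to `x_i^{(j+1)}`. -/
def diffDer (K : Type*) [CommRing K] (n : ℕ) :
    Derivation K (MvPolynomial (Fin n × ℕ) K) (MvPolynomial (Fin n × ℕ) K) :=
  MvPolynomial.mkDerivation K fun v => X (v.1, v.2 + 1)

/-- The differential ideal generated by a set `S`. -/
def diffIdeal (K : Type*) [CommRing K] (n : ℕ) (S : Set (MvPolynomial (Fin n × ℕ) K)) :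
    Ideal (MvPolynomial (Fin n × ℕ) K) :=
  Ideal.span {q | ∃ f ∈ S, ∃ j : ℕ, q = (⇑(diffDer K n))^[j] f}

/-- The differential ideal `I_g = ⟨x_1' - g_1, …, x_n' - g_n⟩^(∞)`. -/
def sysIdeal (K : Type*) [CommRing K] (n : ℕ) (g : Fin n → MvPolynomial (Fin n) K) :
    Ideal (MvPolynomial (Fin n × ℕ) K) :=
  diffIdeal K n (Set.range fun i => X (i, 1) - rename (fun j => (j, 0)) (g i))

/-- The operator `𝓛*_g = Σ_{i=2}^n g_i ∂/∂x_i + Σ_{j≥0} x_1^{(j+1)} ∂/∂x_1^{(j)}` on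
`K[x_1^{(∞)}, x_2, …, x_n]`, extended by zero on the remaining variables `x_i^{(j)}`,
`i ≠ 1`, `j ≥ 1`. -/
def lieStar (K : Type*) [CommRing K] (n : ℕ) [NeZero n]
    (g : Fin n → MvPolynomial (Fin n) K) :
    Derivation K (MvPolynomial (Fin n × ℕ) K) (MvPolynomial (Fin n × ℕ) K) :=
  MvPolynomial.mkDerivation K fun v =>
    if v.1 = 0 then X (v.1, v.2 + 1)
    else if v.2 = 0 then rename (fun j => (j, 0)) (g v.1) else 0

/-- The Lie derivative `𝓛_g = Σ_{i=1}^n g_i ∂/∂x_i` on `K[x_1, …, x_n]`. -/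
def lieD {K : Type*} [CommRing K] {n : ℕ} (g : Fin n → MvPolynomial (Fin n) K) :
    Derivation K (MvPolynomial (Fin n) K) (MvPolynomial (Fin n) K) :=
  MvPolynomial.mkDerivation K g

/-- The subalgebra `K[x_1, x_1', …, x_1^{(s+1)}, x_2, …, x_n]`. -/
def truncSub (K : Type*) [CommSemiring K] (n s : ℕ) [NeZero n] :
    Subalgebra K (MvPolynomial (Fin n × ℕ) K) :=
  MvPolynomial.supported K {v : Fin n × ℕ | (v.1 = 0 ∧ v.2 ≤ s + 1) ∨ v.2 = 0}

/-- A derivation mapping a generating set `s` into a subalgebra `T ⊇ s` maps the subalgebra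
generated by `s` into `T`. -/
theorem Derivation.mem_of_mem_adjoin {R A : Type*} [CommRing R] [CommRing A] [Algebra R A]
    (d : Derivation R A A) {s : Set A} {T : Subalgebra R A} (hs : s ⊆ T)
    (hd : ∀ x ∈ s, d x ∈ T) {a : A} (ha : a ∈ Algebra.adjoin R s) : d a ∈ T := by
  have hle : Algebra.adjoin R s ≤ T := Algebra.adjoin_le hs
  induction ha using Algebra.adjoin_induction with
  | mem x hx => exact hd x hx
  | algebraMap r => simp
  | add x y hx hy ihx ihy => rw [map_add]; exact T.add_mem ihx ihy
  | mul x y hx hy ihx ihy =>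
    rw [d.leibniz, smul_eq_mul, smul_eq_mul]
    exact T.add_mem (T.mul_mem (hle hx) ihy) (T.mul_mem (hle hy) ihx)

section

variable {K : Type*} [CommRing K] {n : ℕ} (g : Fin n → MvPolynomial (Fin n) K)

/-- The inclusion of `K[x_1, …, x_n]` into the ring of differential polynomials. -/
def inclZero (K : Type*) [CommRing K] (n : ℕ) :
    MvPolynomial (Fin n) K →ₐ[K] MvPolynomial (Fin n × ℕ) K :=
  rename fun j => (j, 0)

/-- Evaluation along the vector field `g`: `x_i^{(j)}` is sent to `𝓛_g^j(x_i)`. -/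
def lieEval : MvPolynomial (Fin n × ℕ) K →ₐ[K] MvPolynomial (Fin n) K :=
  aeval fun v => (⇑(lieD g))^[v.2] (X v.1)

theorem lieEval_X (i : Fin n) (j : ℕ) : lieEval g (X (i, j)) = (⇑(lieD g))^[j] (X i) := by
  simp [lieEval]

theorem lieD_X (i : Fin n) : lieD g (X i) = g i := by
  simp [lieD, mkDerivation_X]

theorem lieEval_X_succ (i : Fin n) (j : ℕ) :
    lieEval g (X (i, j + 1)) = (⇑(lieD g))^[j] (g i) := by
  rw [lieEval_X, Function.iterate_succ_apply, lieD_X]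

theorem inclZero_X (i : Fin n) : inclZero K n (X i) = X (i, 0) := by
  simp [inclZero]

theorem lieEval_inclZero (p : MvPolynomial (Fin n) K) : lieEval g (inclZero K n p) = p := by
  have h : (lieEval g).comp (inclZero K n) = AlgHom.id K _ := by
    ext i : 1
    simp [inclZero_X, lieEval_X]
  exact DFunLike.congr_fun h p

theorem lieEval_diffDer (p : MvPolynomial (Fin n × ℕ) K) :
    lieEval g (diffDer K n p) = lieD g (lieEval g p) := by
  induction p using MvPolynomial.induction_on with
  | C a => simp [← algebraMap_eq]
  | add p q hp hq => simp [hp, hq]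
  | mul_X p v hp =>
    have hv : lieEval g (diffDer K n (X v)) = lieD g (lieEval g (X v)) := by
      rw [diffDer, mkDerivation_X, lieEval_X, lieEval_X, Function.iterate_succ_apply']
    simp [Derivation.leibniz, hp, hv]

theorem diffDer_mem_sysIdeal {p : MvPolynomial (Fin n × ℕ) K} (hp : p ∈ sysIdeal K n g) :
    diffDer K n p ∈ sysIdeal K n g := by
  unfold sysIdeal diffIdeal at hp ⊢
  induction hp using Submodule.span_induction with
  | mem x hx =>
    obtain ⟨f, hf, j, rfl⟩ := hx
    exact Ideal.subset_span ⟨f, hf, j + 1, (Function.iterate_succ_apply' _ _ _).symm⟩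
  | zero => simp
  | add x y _ _ hx hy => rw [map_add]; exact Ideal.add_mem _ hx hy
  | smul a x hx' hx =>
    rw [smul_eq_mul, Derivation.leibniz, smul_eq_mul, smul_eq_mul]
    exact Ideal.add_mem _ (Ideal.mul_mem_left _ _ hx) (Ideal.mul_mem_right _ _ hx')

theorem diffDer_inclZero_sub_mem (p : MvPolynomial (Fin n) K) :
    diffDer K n (inclZero K n p) - inclZero K n (lieD g p) ∈ sysIdeal K n g := by
  induction p using MvPolynomial.induction_on with
  | C a => simp [← algebraMap_eq]
  | add p q hp hq =>
    simp only [map_add]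
    rw [add_sub_add_comm]
    exact Ideal.add_mem _ hp hq
  | mul_X p i hp =>
    have hi : X (i, 1) - inclZero K n (g i) ∈ sysIdeal K n g :=
      Ideal.subset_span ⟨_, ⟨i, rfl⟩, 0, rfl⟩
    have hX : diffDer K n (X (i, 0)) = X (i, 1) := by simp [diffDer, mkDerivation_X]
    simp only [map_mul, map_add, Derivation.leibniz, smul_eq_mul, lieD_X, inclZero_X, hX]
    convert Ideal.add_mem _ (Ideal.mul_mem_left _ (inclZero K n p) hi)
      (Ideal.mul_mem_left _ (X (i, 0)) hp) using 1
    ring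

theorem sub_inclZero_lieEval_mem (p : MvPolynomial (Fin n × ℕ) K) :
    p - inclZero K n (lieEval g p) ∈ sysIdeal K n g := by
  induction p using MvPolynomial.induction_on with
  | C a => simp [← algebraMap_eq]
  | add p q hp hq =>
    simp only [map_add]
    rw [add_sub_add_comm]
    exact Ideal.add_mem _ hp hq
  | mul_X p v hp =>
    obtain ⟨i, j⟩ := v
    have hv : X (i, j) - inclZero K n (lieEval g (X (i, j))) ∈ sysIdeal K n g := by
      induction j with
      | zero => simp [lieEval_X, inclZero_X]
      | succ j ih =>
        have hX : diffDer K n (X (i, j)) = X (i, j + 1) := by simp [diffDer, mkDerivation_X]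
        have h := Ideal.add_mem _ (diffDer_mem_sysIdeal g ih)
          (diffDer_inclZero_sub_mem g (lieEval g (X (i, j))))
        rwa [map_sub, sub_add_sub_cancel, ← lieEval_diffDer, hX] at h
    rw [map_mul, map_mul]
    convert Ideal.add_mem _ (Ideal.mul_mem_left _ p hv)
      (Ideal.mul_mem_left _ (inclZero K n (lieEval g (X (i, j)))) hp) using 1
    ring

/-- The differential ideal `I_g` is the kernel of the evaluation along `g`. -/
theorem mem_sysIdeal_iff (p : MvPolynomial (Fin n × ℕ) K) :
    p ∈ sysIdeal K n g ↔ lieEval g p = 0 := by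
  refine ⟨fun hp => ?_, fun hp => by simpa [hp] using sub_inclZero_lieEval_mem g p⟩
  suffices h : sysIdeal K n g ≤ RingHom.ker (lieEval g) from h hp
  refine Ideal.span_le.2 ?_
  rintro _ ⟨_, ⟨i, rfl⟩, j, rfl⟩
  have hsemi : Function.Semiconj (lieEval g) (diffDer K n) (lieD g) := lieEval_diffDer g
  have h0 : lieEval g (X (i, 1) - rename (fun j => (j, 0)) (g i)) = 0 := by
    rw [map_sub, lieEval_X_succ]
    exact sub_eq_zero.2 (lieEval_inclZero g (g i)).symm
  rw [SetLike.mem_coe, RingHom.mem_ker, (hsemi.iterate_right j).eq, h0]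
  exact iterate_map_zero _ j

variable [NeZero n]

/-- The polynomial ring `K[x_1, …, x_1^{(m)}, x_2, …, x_n]`. -/
def jetSub (K : Type*) [CommRing K] (n m : ℕ) [NeZero n] :
    Subalgebra K (MvPolynomial (Fin n × ℕ) K) :=
  MvPolynomial.supported K {v : Fin n × ℕ | (v.1 = 0 ∧ v.2 ≤ m) ∨ v.2 = 0}

theorem jetSub_mono {k m : ℕ} (h : k ≤ m) : jetSub K n k ≤ jetSub K n m :=
  supported_mono fun _ hv => hv.imp (fun hv => ⟨hv.1, hv.2.trans h⟩) id

theorem X_mem_jetSub {m : ℕ} {v : Fin n × ℕ} (h : (v.1 = 0 ∧ v.2 ≤ m) ∨ v.2 = 0) :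
    (X v : MvPolynomial (Fin n × ℕ) K) ∈ jetSub K n m :=
  Algebra.subset_adjoin ⟨v, h, rfl⟩

theorem inclZero_mem_jetSub (p : MvPolynomial (Fin n) K) (m : ℕ) :
    inclZero K n p ∈ jetSub K n m := by
  induction p using MvPolynomial.induction_on with
  | C a => rw [← algebraMap_eq, AlgHom.commutes]; exact Subalgebra.algebraMap_mem _ a
  | add p q hp hq => rw [map_add]; exact Subalgebra.add_mem _ hp hq
  | mul_X p i hp =>
    rw [map_mul, inclZero_X]
    exact Subalgebra.mul_mem _ hp (X_mem_jetSub (Or.inr rfl))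

theorem lieStar_X_zero (j : ℕ) : lieStar K n g (X (0, j)) = X (0, j + 1) := by
  simp [lieStar, mkDerivation_X]

theorem lieStar_X_of_ne {i : Fin n} (hi : i ≠ 0) :
    lieStar K n g (X (i, 0)) = inclZero K n (g i) := by
  simp [lieStar, mkDerivation_X, hi, inclZero]

theorem lieStar_mem_jetSub {m : ℕ} {p : MvPolynomial (Fin n × ℕ) K} (hp : p ∈ jetSub K n m) :
    lieStar K n g p ∈ jetSub K n (m + 1) := by
  refine Derivation.mem_of_mem_adjoin _
    (Algebra.subset_adjoin.trans (jetSub_mono (K := K) m.le_succ)) ?_ hp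
  rintro _ ⟨⟨i, j⟩, hv, rfl⟩
  by_cases hi : i = 0
  · subst hi
    rw [lieStar_X_zero]
    exact X_mem_jetSub (by simp at hv ⊢; omega)
  · obtain rfl : j = 0 := by simpa [hi] using hv
    rw [lieStar_X_of_ne g hi]
    exact inclZero_mem_jetSub _ _

theorem lieStar_iterate_mem_jetSub {m : ℕ} {p : MvPolynomial (Fin n × ℕ) K}
    (hp : p ∈ jetSub K n m) (i : ℕ) : (⇑(lieStar K n g))^[i] p ∈ jetSub K n (m + i) := by
  induction i with
  | zero => exact hp
  | succ i ih => rw [Function.iterate_succ_apply']; exact lieStar_mem_jetSub g ih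

theorem lieEval_lieStar {m : ℕ} {p : MvPolynomial (Fin n × ℕ) K} (hp : p ∈ jetSub K n m) :
    lieEval g (lieStar K n g p) = lieD g (lieEval g p) := by
  unfold jetSub supported at hp
  induction hp using Algebra.adjoin_induction with
  | mem x hx =>
    obtain ⟨⟨i, j⟩, hv, rfl⟩ := hx
    by_cases hi : i = 0
    · subst hi
      rw [lieStar_X_zero, lieEval_X, lieEval_X, Function.iterate_succ_apply']
    · obtain rfl : j = 0 := by simpa [hi] using hv
      rw [lieStar_X_of_ne g hi, lieEval_inclZero, lieEval_X, Function.iterate_zero_apply, lieD_X]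
  | algebraMap r => simp
  | add x y _ _ hx hy => simp [hx, hy]
  | mul x y _ _ hx hy => simp [Derivation.leibniz, hx, hy]

theorem lieEval_lieStar_iterate {m : ℕ} {p : MvPolynomial (Fin n × ℕ) K}
    (hp : p ∈ jetSub K n m) (i : ℕ) :
    lieEval g ((⇑(lieStar K n g))^[i] p) = (⇑(lieD g))^[i] (lieEval g p) := by
  induction i with
  | zero => rfl
  | succ i ih =>
    rw [Function.iterate_succ_apply', Function.iterate_succ_apply',
      lieEval_lieStar g (lieStar_iterate_mem_jetSub g hp i), ih]

theorem lieStar_iterate_X_zero (i j : ℕ) :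
    (⇑(lieStar K n g))^[i] (X (0, j)) = X (0, j + i) := by
  induction i with
  | zero => rfl
  | succ i ih => rw [Function.iterate_succ_apply', ih, lieStar_X_zero, add_assoc]

theorem lieStar_iterate_sub (i : ℕ) :
    (⇑(lieStar K n g))^[i] (X (0, 1) - inclZero K n (g 0)) =
      X (0, i + 1) - (⇑(lieStar K n g))^[i] (inclZero K n (g 0)) := by
  rw [iterate_map_sub, lieStar_iterate_X_zero, add_comm 1 i]

/-- If an ideal of a subalgebra contains the differences `x_1^{(i+1)} - 𝓛_g^i(g_1)` for `i < m`,
then every element of `K[x_1, …, x_1^{(m)}, x_2, …, x_n]` is congruent to its evaluation along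
`g` modulo that ideal. -/
theorem sub_inclZero_lieEval_mem_of_mem {m : ℕ} {B : Subalgebra K (MvPolynomial (Fin n × ℕ) K)}
    (hB : jetSub K n m ≤ B) (I : Ideal B)
    (hI : ∀ i < m, ∃ h : X (0, i + 1) - inclZero K n ((⇑(lieD g))^[i] (g 0)) ∈ B, ⟨_, h⟩ ∈ I)
    {p : MvPolynomial (Fin n × ℕ) K} (hp : p ∈ jetSub K n m) :
    ∃ h : p - inclZero K n (lieEval g p) ∈ B, ⟨_, h⟩ ∈ I := by
  have hincl (q) : inclZero K n q ∈ B := hB (inclZero_mem_jetSub q m)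
  have of_eq {q : MvPolynomial (Fin n × ℕ) K} {b : B} (hb : b ∈ I) (hq : q = b) :
      ∃ h : q ∈ B, ⟨q, h⟩ ∈ I := by
    subst hq
    exact ⟨b.2, hb⟩
  unfold jetSub supported at hp
  induction hp using Algebra.adjoin_induction with
  | mem x hx =>
    obtain ⟨⟨i, j⟩, hv, rfl⟩ := hx
    cases j with
    | zero => exact of_eq I.zero_mem (by simp [lieEval_X, inclZero_X])
    | succ j =>
      obtain ⟨rfl, hj⟩ : i = 0 ∧ j + 1 ≤ m := by simpa using hv
      rw [lieEval_X_succ]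
      exact hI j hj
  | algebraMap r => exact of_eq I.zero_mem (by simp)
  | add x y _ _ hx hy =>
    obtain ⟨hx, hx'⟩ := hx
    obtain ⟨hy, hy'⟩ := hy
    refine of_eq (I.add_mem hx' hy') ?_
    rw [map_add, map_add, add_sub_add_comm, B.coe_add]
  | mul x y hxm _ hx hy =>
    obtain ⟨hx, hx'⟩ := hx
    obtain ⟨hy, hy'⟩ := hy
    refine of_eq (I.add_mem (I.mul_mem_left ⟨x, hB hxm⟩ hy')
      (I.mul_mem_left ⟨_, hincl (lieEval g y)⟩ hx')) ?_
    rw [B.coe_add, B.coe_mul, B.coe_mul, map_mul, map_mul]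
    ring

/-- An ideal containing `(𝓛*_g)^i(x_1' - g_1)` for all `i < m` contains `x_1^{(i+1)} - 𝓛_g^i(g_1)`
for all `i < m`. -/
theorem X_sub_inclZero_mem_of_lieStar_iterate_mem {m : ℕ}
    {B : Subalgebra K (MvPolynomial (Fin n × ℕ) K)} (hB : jetSub K n m ≤ B) (I : Ideal B)
    (hI : ∀ i < m, ∃ h : (⇑(lieStar K n g))^[i] (X (0, 1) - inclZero K n (g 0)) ∈ B, ⟨_, h⟩ ∈ I)
    {i : ℕ} (hi : i < m) :
    ∃ h : X (0, i + 1) - inclZero K n ((⇑(lieD g))^[i] (g 0)) ∈ B, ⟨_, h⟩ ∈ I := by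
  induction i using Nat.strong_induction_on with
  | _ i ih =>
    have hr := lieStar_iterate_mem_jetSub g (inclZero_mem_jetSub (g 0) 0) i
    rw [zero_add] at hr
    obtain ⟨h₁, h₁'⟩ := sub_inclZero_lieEval_mem_of_mem g ((jetSub_mono hi.le).trans hB) I
      (fun k hk => ih k hk (hk.trans hi)) hr
    obtain ⟨h₂, h₂'⟩ := hI i hi
    have key : (⇑(lieStar K n g))^[i] (X (0, 1) - inclZero K n (g 0)) +
        ((⇑(lieStar K n g))^[i] (inclZero K n (g 0)) -
          inclZero K n (lieEval g ((⇑(lieStar K n g))^[i] (inclZero K n (g 0))))) =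
        X (0, i + 1) - inclZero K n ((⇑(lieD g))^[i] (g 0)) := by
      rw [lieStar_iterate_sub, lieEval_lieStar_iterate g (inclZero_mem_jetSub (g 0) 0),
        lieEval_inclZero, sub_add_sub_cancel]
    rw [← key]
    exact ⟨B.add_mem h₂ h₁, I.add_mem h₂' h₁'⟩

end

theorem statement4 (K : Type*) [Field K] [CharZero K] (n : ℕ) [NeZero n]
    (g : Fin n → MvPolynomial (Fin n) K) (s : ℕ) :
    Ideal.span {a : truncSub K n s |
        (a : MvPolynomial (Fin n × ℕ) K) ∈
          Set.range fun i : Fin (s + 1) =>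
            (⇑(lieStar K n g))^[(i : ℕ)]
              (X ((0 : Fin n), 1) - rename (fun j => (j, 0)) (g 0))} =
      Ideal.comap (truncSub K n s).val (sysIdeal K n g) ∧
    Ideal.span {a : truncSub K n s |
        (a : MvPolynomial (Fin n × ℕ) K) ∈
          Set.range fun i : Fin (s + 1) =>
            (⇑(lieStar K n g))^[(i : ℕ)]
              (X ((0 : Fin n), 1) - rename (fun j => (j, 0)) (g 0))} =
      Ideal.span {a : truncSub K n s |
        (a : MvPolynomial (Fin n × ℕ) K) ∈
          Set.range fun i : Fin (s + 1) =>
            X ((0 : Fin n), (i : ℕ) + 1) -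
              rename (fun j => (j, 0)) ((⇑(lieD g))^[(i : ℕ)] (g 0))} := by
  have hB : jetSub K n (s + 1) ≤ truncSub K n s := le_rfl
  have hgen : X (0, 1) - inclZero K n (g 0) ∈ jetSub K n 1 :=
    Subalgebra.sub_mem _ (X_mem_jetSub (by simp)) (inclZero_mem_jetSub _ _)
  set I₁ := Ideal.span {a : truncSub K n s |
        (a : MvPolynomial (Fin n × ℕ) K) ∈
          Set.range fun i : Fin (s + 1) =>
            (⇑(lieStar K n g))^[(i : ℕ)]
              (X ((0 : Fin n), 1) - rename (fun j => (j, 0)) (g 0))}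
  set I₂ := Ideal.span {a : truncSub K n s |
        (a : MvPolynomial (Fin n × ℕ) K) ∈
          Set.range fun i : Fin (s + 1) =>
            X ((0 : Fin n), (i : ℕ) + 1) -
              rename (fun j => (j, 0)) ((⇑(lieD g))^[(i : ℕ)] (g 0))}
  have h₁ : I₁ ≤ Ideal.comap (truncSub K n s).val (sysIdeal K n g) := by
    refine Ideal.span_le.2 ?_
    rintro a ⟨i, hi⟩
    change (a : MvPolynomial (Fin n × ℕ) K) ∈ sysIdeal K n g
    rw [mem_sysIdeal_iff, ← hi]
    refine (lieEval_lieStar_iterate g hgen i).trans ?_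
    rw [map_sub, lieEval_inclZero, lieEval_X_succ, Function.iterate_zero_apply, sub_self]
    exact iterate_map_zero _ _
  have h₂ : Ideal.comap (truncSub K n s).val (sysIdeal K n g) ≤ I₂ := by
    intro a ha
    have ha' : lieEval g a = 0 := (mem_sysIdeal_iff g _).1 ha
    obtain ⟨h, h'⟩ := sub_inclZero_lieEval_mem_of_mem g hB I₂
      (fun i hi => ⟨hB (Subalgebra.sub_mem _ (X_mem_jetSub (by simp; omega))
        (inclZero_mem_jetSub _ _)), Ideal.subset_span ⟨⟨i, hi⟩, rfl⟩⟩) a.2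
    convert h'
    simp [ha']
  have h₃ : I₂ ≤ I₁ := by
    refine Ideal.span_le.2 ?_
    rintro ⟨a, ha⟩ ⟨i, rfl⟩
    obtain ⟨h, h'⟩ := X_sub_inclZero_mem_of_lieStar_iterate_mem g hB I₁
      (fun i hi => ⟨hB (jetSub_mono (by omega) (lieStar_iterate_mem_jetSub g hgen i)),
        Ideal.subset_span ⟨⟨i, hi⟩, rfl⟩⟩) i.2
    exact h'
  exact ⟨le_antisymm h₁ (h₂.trans h₃), le_antisymm (h₁.trans h₂) h₃⟩
end
end

section
/- Let K be a field of characteristic zero and let g be a square-free polynomial in K[x_1, ..., x_n, y_1, ..., y_k]. Then for every tuple (ω_1, ..., ω_k) of nonnegative integers there exists a K-algebra homomorphism φ : K[x_1, ..., x_n, y_1, ..., y_k] → K[x_1, ..., x_n, z_1, ..., z_k] with φ(x_i) = x_i for all i and φ(y_i) = p_i(z_i) for some p_i ∈ K[z_i] with deg p_i = ω_i, such that φ(g) is square-free. -/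
open MvPolynomial

noncomputable section

open scoped nonZeroDivisors

/-- Gauss's lemma for square-free polynomials. -/
theorem Polynomial.squarefree_map_fractionRing {R : Type*} [CommRing R] [IsDomain R]
    [UniqueFactorizationMonoid R] {f : Polynomial R} (hf : Squarefree f) :
    Squarefree (f.map (algebraMap R (FractionRing R))) := by
  let : NormalizedGCDMonoid R := Nonempty.some inferInstance
  have hf0 : f.map (algebraMap R (FractionRing R)) ≠ 0 := by
    rw [Ne, Polynomial.map_eq_zero_iff (IsFractionRing.injective R (FractionRing R))]
    exact hf.ne_zero
  intro q hq
  have hq0 : q ≠ 0 := by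
    rintro rfl
    exact hf0 (by simpa using hq)
  obtain ⟨b, hb, hbq⟩ := IsLocalization.integerNormalization_spec R⁰ q
  set N := IsLocalization.integerNormalization R⁰ q
  have hunit : IsUnit (Polynomial.C (algebraMap R (FractionRing R) b)) :=
    Polynomial.isUnit_C.2 (IsLocalization.map_units (FractionRing R) ⟨b, hb⟩)
  have hdvd : N.primPart.map (algebraMap R (FractionRing R)) ∣ q := by
    have h := Polynomial.map_dvd (algebraMap R (FractionRing R)) N.primPart_dvd
    rw [hbq, Algebra.smul_def, Polynomial.algebraMap_apply] at h
    exact (hunit.dvd_mul_left).1 h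
  have hsq : N.primPart * N.primPart ∣ f := by
    refine (N.isPrimitive_primPart.mul
      N.isPrimitive_primPart).dvd_of_fraction_map_dvd_fraction_map (K := FractionRing R) ?_
    rw [Polynomial.map_mul]
    exact (mul_dvd_mul hdvd hdvd).trans hq
  exact Polynomial.isUnit_or_eq_zero_of_isUnit_integerNormalization_primPart hq0 (hf _ hsq)

theorem Polynomial.exists_mul_add_mul_derivative_eq_C {R : Type*} [CommRing R] [IsDomain R]
    [UniqueFactorizationMonoid R] [CharZero R] {f : Polynomial R} (hf : Squarefree f) :
    ∃ (u v : Polynomial R) (r : R), r ≠ 0 ∧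
      u * f + v * Polynomial.derivative f = Polynomial.C r := by
  have : CharZero (FractionRing R) :=
    charZero_of_injective_algebraMap (IsFractionRing.injective R (FractionRing R))
  obtain ⟨a, b, hab⟩ := PerfectField.separable_iff_squarefree.2
    (Polynomial.squarefree_map_fractionRing hf)
  obtain ⟨c, hc, hca⟩ := IsLocalization.integerNormalization_spec R⁰ a
  obtain ⟨d, hd, hdb⟩ := IsLocalization.integerNormalization_spec R⁰ b
  refine ⟨Polynomial.C d * IsLocalization.integerNormalization R⁰ a,
    Polynomial.C c * IsLocalization.integerNormalization R⁰ b, c * d,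
    mul_ne_zero (nonZeroDivisors.ne_zero hc) (nonZeroDivisors.ne_zero hd),
    Polynomial.map_injective _ (IsFractionRing.injective R (FractionRing R)) ?_⟩
  simp only [Polynomial.map_add, Polynomial.map_mul, Polynomial.map_C, hca, hdb, map_mul,
    Algebra.smul_def, Polynomial.algebraMap_apply]
  rw [Polynomial.derivative_map] at hab
  linear_combination (Polynomial.C (algebraMap R (FractionRing R) c) *
    Polynomial.C (algebraMap R (FractionRing R) d)) * hab

namespace MvPolynomial

variable {σ K : Type*} [Field K]

/-- A multivariate polynomial ring viewed as a univariate polynomial ring in one chosen variable. -/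
def equivPolynomialAt (K : Type*) [Field K] [DecidableEq σ] (i : σ) :
    MvPolynomial σ K ≃ₐ[K] Polynomial (MvPolynomial {j // j ≠ i} K) :=
  (renameEquiv K (Equiv.optionSubtypeNe i).symm).trans (optionEquivLeft K _)

theorem equivPolynomialAt_pderiv [DecidableEq σ] (i : σ) (f : MvPolynomial σ K) :
    equivPolynomialAt K i (pderiv i f) = Polynomial.derivative (equivPolynomialAt K i f) := by
  induction f using MvPolynomial.induction_on with
  | C a => simp [equivPolynomialAt]
  | add p q hp hq => simp [hp, hq]
  | mul_X p j hp =>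
    by_cases hj : j = i
    · subst hj
      rw [pderiv_mul, pderiv_X_self, map_add, map_mul, map_mul, hp, map_mul,
        Polynomial.derivative_mul]
      simp [equivPolynomialAt]
    · rw [pderiv_mul, pderiv_X_of_ne hj, map_add, map_mul, map_mul, hp, map_mul,
        Polynomial.derivative_mul]
      simp [equivPolynomialAt, Equiv.optionSubtypeNe_symm_of_ne hj]

theorem equivPolynomialAt_symm_C_mem_supported [DecidableEq σ] (i : σ)
    (r : MvPolynomial {j // j ≠ i} K) :
    (equivPolynomialAt K i).symm (Polynomial.C r) ∈ supported K {i}ᶜ := by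
  have h : (equivPolynomialAt K i).symm (Polynomial.C r) = rename Subtype.val r := by
    rw [AlgEquiv.symm_apply_eq]
    induction r using MvPolynomial.induction_on with
    | C a => simp [equivPolynomialAt]
    | add p q hp hq => simp [hp, hq]
    | mul_X p j hp =>
      rw [Polynomial.C_mul, hp, map_mul, map_mul]
      simp [equivPolynomialAt, Equiv.optionSubtypeNe_symm_of_ne j.2]
  rw [h, supported_eq_range_rename]
  exact ⟨r, rfl⟩

theorem exists_mul_add_mul_pderiv_mem_supported [CharZero K] {f : MvPolynomial σ K}
    (hf : Squarefree f) (i : σ) :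
    ∃ u v r : MvPolynomial σ K, r ≠ 0 ∧ r ∈ supported K {i}ᶜ ∧ u * f + v * pderiv i f = r := by
  classical
  let e := equivPolynomialAt K i
  have hef : Squarefree (e f) := fun q hq => by
    have h := hf (e.symm q) (by simpa using map_dvd e.symm hq)
    simpa using h.map e
  obtain ⟨u, v, r, hr, h⟩ := Polynomial.exists_mul_add_mul_derivative_eq_C hef
  refine ⟨e.symm u, e.symm v, e.symm (Polynomial.C r), by simpa using hr,
    equivPolynomialAt_symm_C_mem_supported i r, e.injective ?_⟩
  simpa [e, equivPolynomialAt_pderiv] using h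

theorem degreeOf_eq_zero_of_dvd_of_mem_supported {h s : MvPolynomial σ K} {i : σ} (hs : s ≠ 0)
    (hmem : s ∈ supported K {i}ᶜ) (hdvd : h ∣ s) : degreeOf i h = 0 := by
  obtain ⟨t, rfl⟩ := hdvd
  have h0 : degreeOf i (h * t) = 0 := by
    by_contra hne
    exact mem_supported.1 hmem (mem_vars_iff_degreeOf_ne_zero.2 hne) rfl
  rw [degreeOf_mul_eq (left_ne_zero_of_mul hs) (right_ne_zero_of_mul hs)] at h0
  omega

theorem irreducible_X_sub_C (i : σ) (b : K) :
    Irreducible (X i - C b : MvPolynomial σ K) := by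
  classical
  have hcoeff : (X i - C b : MvPolynomial σ K).coeff (Finsupp.single i 1) = 1 := by
    simp [coeff_C, eq_comm (a := (0 : σ →₀ ℕ))]
  refine irreducible_of_totalDegree_eq_one (le_antisymm ?_ ?_) fun x hx => ?_
  · exact (totalDegree_sub_C_le _ _).trans (totalDegree_X i).le
  · have := le_totalDegree (p := (X i - C b : MvPolynomial σ K)) (s := Finsupp.single i 1)
      (by rw [mem_support_iff, hcoeff]; exact one_ne_zero)
    simpa using this
  · exact isUnit_of_dvd_one (hcoeff ▸ hx (Finsupp.single i 1))

/-- The endomorphism substituting for each variable a univariate polynomial in that variable. -/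
def substVars (p : σ → Polynomial K) : MvPolynomial σ K →ₐ[K] MvPolynomial σ K :=
  aeval fun i => Polynomial.aeval (X i) (p i)

theorem polynomial_aeval_X_mem_supported {s : Set σ} {j : σ} (hj : j ∈ s) (p : Polynomial K) :
    Polynomial.aeval (X j : MvPolynomial σ K) p ∈ supported K s := by
  have hX : (X j : MvPolynomial σ K) ∈ supported K s := Algebra.subset_adjoin ⟨j, hj, rfl⟩
  have h := (Polynomial.aeval (⟨X j, hX⟩ : supported K s) p).2
  rwa [Polynomial.aeval_subalgebra_coe] at h

theorem substVars_mem_supported (p : σ → Polynomial K) {s : Set σ} {r : MvPolynomial σ K}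
    (hr : r ∈ supported K s) : substVars p r ∈ supported K s := by
  have h : supported K s ≤ (supported K s).comap (substVars p) := by
    refine Algebra.adjoin_le ?_
    rintro _ ⟨j, hj, rfl⟩
    simpa [substVars] using polynomial_aeval_X_mem_supported hj (p j)
  exact h hr

theorem substVars_mem_supported_of_eq_C {p : σ → Polynomial K} {i : σ} {d : K}
    (hp : p i = Polynomial.C d) (f : MvPolynomial σ K) : substVars p f ∈ supported K {i}ᶜ := by
  induction f using MvPolynomial.induction_on with
  | C a => simpa [substVars] using (supported K {i}ᶜ).algebraMap_mem a
  | add f g hf hg => simpa using add_mem hf hg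
  | mul_X f j hf =>
    rw [map_mul]
    refine mul_mem hf ?_
    by_cases hj : j = i
    · subst hj
      simpa [substVars, hp] using (supported K {j}ᶜ).algebraMap_mem d
    · simpa [substVars] using polynomial_aeval_X_mem_supported (s := {i}ᶜ) hj (p j)

theorem eval_substVars (p : σ → Polynomial K) (b : σ → K) (f : MvPolynomial σ K) :
    eval b (substVars p f) = eval (fun i => (p i).eval (b i)) f := by
  induction f using MvPolynomial.induction_on with
  | C a => simp [substVars]
  | add f g hf hg => simp [hf, hg]
  | mul_X f j hf =>
    rw [map_mul, map_mul, hf, map_mul]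
    congr 1
    rw [substVars, aeval_X, eval_X, ← coe_aeval_eq_eval, RingHom.coe_coe,
      ← Polynomial.aeval_algHom_apply]
    simp

theorem pderiv_substVars (p : σ → Polynomial K) (i : σ) (f : MvPolynomial σ K) :
    pderiv i (substVars p f) =
      Polynomial.aeval (X i) (Polynomial.derivative (p i)) * substVars p (pderiv i f) := by
  classical
  induction f using MvPolynomial.induction_on with
  | C a => simp [substVars]
  | add f g hf hg => simp [hf, hg, mul_add]
  | mul_X f j hf =>
    have hX : pderiv i (Polynomial.aeval (X j : MvPolynomial σ K) (p j)) =
        Polynomial.aeval (X j) (Polynomial.derivative (p j)) * pderiv i (X j) := by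
      rw [Derivation.map_aeval, smul_eq_mul]
    have hX' : substVars p (X j) = Polynomial.aeval (X j : MvPolynomial σ K) (p j) := by
      simp [substVars]
    rw [map_mul, pderiv_mul, pderiv_mul, hf, map_add, map_mul, map_mul, hX', hX]
    by_cases hj : j = i
    · subst hj
      simp
      ring
    · simp [pderiv_X_of_ne hj]
      ring

theorem isUnit_of_forall_degreeOf_eq_zero {h : MvPolynomial σ K} (h0 : h ≠ 0)
    (hdeg : ∀ i, degreeOf i h = 0) : IsUnit h := by
  have hvars : h.vars = ∅ := Finset.eq_empty_of_forall_notMem fun i hi =>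
    mem_vars_iff_degreeOf_ne_zero.1 hi (hdeg i)
  obtain ⟨c, rfl⟩ : ∃ c, h = C c := ⟨_, vars_eq_empty_iff_eq_C.1 hvars⟩
  exact (isUnit_iff_ne_zero.2 fun hc => h0 (by simp [hc])).map C

/-- Substituting into `f` polynomials `p i` whose only critical point is `b i` preserves
square-freeness, provided that the values `p i (b i)` avoid the zeros of `f` and of the elements
`r i`, which are free of the `i`-th variable and lie in the ideal of `f` and its derivative. -/
theorem squarefree_substVars {f : MvPolynomial σ K} {p : σ → Polynomial K} {b : σ → K}
    {u v r : σ → MvPolynomial σ K}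
    (hr : ∀ i, r i ∈ supported K {i}ᶜ) (huv : ∀ i, u i * f + v i * pderiv i f = r i)
    (hp : ∀ i, (∃ d, p i = Polynomial.C d) ∨ ∃ (e : K) (m : ℕ), e ≠ 0 ∧
      Polynomial.derivative (p i) = Polynomial.C e * (Polynomial.X - Polynomial.C (b i)) ^ m)
    (hf0 : eval (fun i => (p i).eval (b i)) f ≠ 0)
    (hr0 : ∀ i, eval (fun i => (p i).eval (b i)) (r i) ≠ 0) :
    Squarefree (substVars p f) := by
  have hne : ∀ {g : MvPolynomial σ K}, eval (fun i => (p i).eval (b i)) g ≠ 0 →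
      substVars p g ≠ 0 := fun hg h => hg (by rw [← eval_substVars, h, map_zero])
  rw [squarefree_iff_irreducible_sq_not_dvd_of_ne_zero (hne hf0)]
  intro h hirr hsq
  refine hirr.not_isUnit (isUnit_of_forall_degreeOf_eq_zero hirr.ne_zero fun i => ?_)
  have hdvd : h ∣ substVars p f := (dvd_mul_right h h).trans hsq
  rcases hp i with ⟨d, hd⟩ | ⟨e, m, he, hem⟩
  · exact degreeOf_eq_zero_of_dvd_of_mem_supported (hne hf0)
      (substVars_mem_supported_of_eq_C hd f) hdvd
  have hdvd' : h ∣ pderiv i (substVars p f) := by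
    obtain ⟨t, ht⟩ := hsq
    rw [ht, pderiv_mul, pderiv_mul]
    exact ⟨pderiv i h * t + pderiv i h * t + h * pderiv i t, by ring⟩
  have hmul : h ∣ C e * ((X i - C (b i)) ^ m * substVars p (r i)) := by
    have hval : Polynomial.aeval (X i : MvPolynomial σ K) (Polynomial.derivative (p i)) =
        C e * (X i - C (b i)) ^ m := by
      simp [hem, algebraMap_eq]
    have key : C e * ((X i - C (b i)) ^ m * substVars p (r i)) =
        C e * (X i - C (b i)) ^ m * substVars p (u i) * substVars p f +
          substVars p (v i) * pderiv i (substVars p f) := by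
      rw [← huv i, pderiv_substVars, hval, map_add, map_mul, map_mul]
      ring
    rw [key]
    exact dvd_add (hdvd.mul_left _) (hdvd'.mul_left _)
  have hprime : Prime h := hirr.prime
  rcases hprime.dvd_or_dvd hmul with h1 | h1
  · exact absurd (isUnit_of_dvd_unit h1 ((isUnit_iff_ne_zero.2 he).map C)) hirr.not_isUnit
  rcases hprime.dvd_or_dvd h1 with h2 | h2
  · have hassoc := hirr.associated_of_dvd (irreducible_X_sub_C i (b i))
      (hprime.dvd_of_dvd_pow h2)
    have h3 := map_dvd (eval b) (hassoc.symm.dvd.trans hdvd)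
    rw [eval_substVars] at h3
    simp only [map_sub, eval_X, eval_C, sub_self, zero_dvd_iff] at h3
    exact absurd h3 hf0
  · exact degreeOf_eq_zero_of_dvd_of_mem_supported (hne (hr0 i))
      (substVars_mem_supported p (hr i)) h2

theorem exists_eval_ne_zero [Infinite K] {f : MvPolynomial σ K} (hf : f ≠ 0) :
    ∃ a, eval a f ≠ 0 := by
  by_contra! h
  exact hf (MvPolynomial.funext fun a => by simpa using h a)

end MvPolynomial

theorem statement7 (K : Type*) [Field K] [CharZero K] (n k : ℕ)
    (g : MvPolynomial (Fin n ⊕ Fin k) K) (hg : Squarefree g) (ω : Fin k → ℕ) :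
    ∃ p : Fin k → Polynomial K, (∀ i, (p i).degree = (ω i : WithBot ℕ)) ∧
      Squarefree
        (MvPolynomial.aeval
          (Sum.elim (fun i : Fin n => (X (Sum.inl i) : MvPolynomial (Fin n ⊕ Fin k) K))
            (fun i : Fin k =>
              Polynomial.aeval (X (Sum.inr i) : MvPolynomial (Fin n ⊕ Fin k) K) (p i))) g) := by
  classical
  choose u v r hr0 hr huv using exists_mul_add_mul_pderiv_mem_supported hg
  obtain ⟨a, ha⟩ := MvPolynomial.exists_eval_ne_zero (K := K)
    (f := g * ((∏ i, r i) * ∏ i, X i)) (mul_ne_zero hg.ne_zero (mul_ne_zero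
      (Finset.prod_ne_zero_iff.2 fun i _ => hr0 i)
      (Finset.prod_ne_zero_iff.2 fun i _ => X_ne_zero i)))
  simp only [map_mul, map_prod, eval_X, mul_ne_zero_iff, Finset.prod_ne_zero_iff] at ha
  obtain ⟨hga, hra, ha0⟩ := ha
  let p : Fin k → Polynomial K := fun i =>
    if ω i = 0 then Polynomial.C (a (Sum.inr i))
    else Polynomial.X ^ ω i + Polynomial.C (a (Sum.inr i))
  refine ⟨p, fun i => ?_, ?_⟩
  · by_cases hi : ω i = 0
    · simp [p, hi, Polynomial.degree_C (ha0 (Sum.inr i) (Finset.mem_univ _))]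
    · simp only [p, hi, if_false]
      exact Polynomial.degree_X_pow_add_C (Nat.pos_of_ne_zero hi) _
  let q : Fin n ⊕ Fin k → Polynomial K := Sum.elim (fun _ => Polynomial.X) p
  let b : Fin n ⊕ Fin k → K := Sum.elim (fun i => a (Sum.inl i)) fun _ => 0
  have hqb : (fun i => (q i).eval (b i)) = a := by
    funext i
    rcases i with i | i
    · simp [q, b]
    · by_cases hi : ω i = 0 <;> simp [q, b, p, hi]
  have hsq : Squarefree (substVars q g) := by
    refine squarefree_substVars (b := b) hr huv (fun i => ?_) (by rwa [hqb])
      fun i => by rw [hqb]; exact hra i (Finset.mem_univ _)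
    rcases i with i | i
    · exact Or.inr ⟨1, 0, one_ne_zero, by simp [q]⟩
    · by_cases hi : ω i = 0
      · exact Or.inl ⟨a (Sum.inr i), by simp [q, p, hi]⟩
      · exact Or.inr ⟨ω i, ω i - 1, Nat.cast_ne_zero.2 hi, by
          simp [q, p, hi, b, Polynomial.derivative_X_pow]⟩
  convert hsq using 2
  rw [substVars]
  congr 1
  funext i
  rcases i with i | i <;> simp [q]
end
end
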